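/- arXiv:2109.13236 — 2 statements merged into one kernel-verified Lean document; each statement's English description precedes it below -/
import Mathlib

section
/- (Gordan's theorem, alternative form) For every real M×L matrix A, exactly one of the following two statements holds: (i) there exists W ∈ ℝ^M such that ⟨W, A_j⟩ > 0 for every column A_j of A; (ii) there exists y ∈ ℝ^L with y ≥ 0 entrywise, y ≠ 0, and Ay = 0. -/
open Matrix

/-- Gordan's theorem (alternative form): for a real `M × L` matrix `A`, exactly
one of the following holds: (i) some `W ∈ ℝ^M` satisfies `⟨W, A_j⟩ > 0` for all
columns `A_j`; (ii) some nonzero entrywise-nonnegative `y ∈ ℝ^L` satisfies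
`A y = 0`. -/
theorem stmt_6 (M L : ℕ) (A : Matrix (Fin M) (Fin L) ℝ) :
    Xor' (∃ W : Fin M → ℝ, ∀ j : Fin L, W ⬝ᵥ (fun i => A i j) > 0)
      (∃ y : Fin L → ℝ, (∀ j, 0 ≤ y j) ∧ y ≠ 0 ∧ A.mulVec y = 0) := by
  refine (xor_iff_or_and_not_and _ _).2 ?_
  constructor
  · by_cases h : (0 : Fin M → ℝ) ∈ A.mulVecLin '' stdSimplex ℝ (Fin L)
    · right
      obtain ⟨y, hy, h0⟩ := h
      refine ⟨y, hy.1, ?_, by simpa using h0⟩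
      rintro rfl
      have := hy.2
      simp at this
    · left
      have hc : IsCompact (A.mulVecLin '' stdSimplex ℝ (Fin L)) :=
        (isCompact_stdSimplex ℝ (Fin L)).image (LinearMap.continuous_on_pi _)
      obtain ⟨f, u, hu, hf⟩ := geometric_hahn_banach_point_closed
        ((convex_stdSimplex ℝ (Fin L)).linear_image A.mulVecLin) hc.isClosed h
      refine ⟨fun i => f (Pi.single i 1), fun j => ?_⟩
      have h1 := hf _ ⟨_, single_mem_stdSimplex ℝ j, rfl⟩
      rw [map_zero] at hu
      have h2 : A.mulVecLin (Pi.single j 1) = ∑ i, A i j • (Pi.single i 1 : Fin M → ℝ) := by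
        ext k
        simp [Finset.sum_apply, Pi.single_apply]
      rw [h2, map_sum] at h1
      simp only [map_smul, smul_eq_mul] at h1
      have h3 : (fun i => f (Pi.single i 1)) ⬝ᵥ (fun i => A i j)
          = ∑ i, A i j * f (Pi.single i 1) := by
        simp only [dotProduct, mul_comm]
      rw [h3]
      linarith
  · rintro ⟨⟨W, hW⟩, y, hy, hne, h0⟩
    apply hne
    have h1 : ∑ j, (W ⬝ᵥ (fun i => A i j)) * y j = 0 := by
      have : W ᵥ* A ⬝ᵥ y = 0 := by rw [← dotProduct_mulVec, h0, dotProduct_zero]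
      exact this
    rw [Finset.sum_eq_zero_iff_of_nonneg
      (fun j _ => mul_nonneg (hW j).le (hy j))] at h1
    ext j
    exact (mul_eq_zero.1 (h1 j (Finset.mem_univ j))).resolve_left (hW j).ne'
end

section
/- Let K, N, M be positive integers, let E_1, …, E_K be real M×N matrices whose concatenation U ∈ ℝ^{M×KN} has full column rank KN, and let each client k have a binary signature B_k = (t_{k1}, …, t_{kN}) ∈ {0,1}^N. Then there exists W ∈ ℝ^M such that, writing σ(x) = 1/(1 + e^{−x}) for the logistic sigmoid, σ((WᵀE_k)_j) > 1/2 whenever t_{kj} = 1 and σ((WᵀE_k)_j) < 1/2 whenever t_{kj} = 0, for every k ∈ {1,…,K} and j ∈ {1,…,N}. (Equivalently, (WᵀE_k)_j > 0 exactly when t_{kj} = 1 and (WᵀE_k)_j < 0 exactly when t_{kj} = 0.) -/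
open Matrix

/-- BCE variant of FedIPR embedding: if the concatenation `U` of the extraction
matrices has full column rank, then there exists `W` such that the logistic
sigmoid of `(Wᵀ E k) j` is above `1/2` whenever the target bit `t k j = 1` and
below `1/2` whenever `t k j = 0`. -/
theorem stmt_9 (K N M : ℕ) (hK : 0 < K) (hN : 0 < N) (hM : 0 < M)
    (E : Fin K → Matrix (Fin M) (Fin N) ℝ)
    (t : Fin K → Fin N → ℝ)
    (ht : ∀ k j, t k j = 0 ∨ t k j = 1)
    (U : Matrix (Fin M) (Fin K × Fin N) ℝ)
    (hU : U = Matrix.of fun i p => E p.1 i p.2)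
    (hrank : U.rank = K * N) :
    ∃ W : Fin M → ℝ, ∀ (k : Fin K) (j : Fin N),
      (t k j = 1 →
        1 / (1 + Real.exp (-(Matrix.vecMul W (E k) j))) > 1 / 2) ∧
      (t k j = 0 →
        1 / (1 + Real.exp (-(Matrix.vecMul W (E k) j))) < 1 / 2) := by
  have hr : LinearMap.range (Uᵀ).mulVecLin = ⊤ := by
    apply Submodule.eq_top_of_finrank_eq
    have h : (Uᵀ).rank = K * N := by rw [Matrix.rank_transpose, hrank]
    rw [Matrix.rank] at h
    rw [h]
    simp
  obtain ⟨W, hW⟩ := LinearMap.range_eq_top.mp hr (fun p => 2 * t p.1 p.2 - 1)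
  refine ⟨W, fun k j => ?_⟩
  have hv : Matrix.vecMul W (E k) j = 2 * t k j - 1 := by
    have h := congrFun hW (k, j)
    rw [Matrix.mulVecLin_apply, Matrix.mulVec_transpose] at h
    rw [← h, hU]
    rfl
  rw [hv]
  constructor
  · intro h
    rw [h]
    have h1 : Real.exp (-(2 * 1 - 1)) < 1 := Real.exp_lt_one_iff.mpr (by norm_num)
    exact one_div_lt_one_div_of_lt (by positivity) (by linarith)
  · intro h
    rw [h]
    have h1 : 1 < Real.exp (-(2 * 0 - 1)) := Real.one_lt_exp_iff.mpr (by norm_num)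
    exact one_div_lt_one_div_of_lt (by positivity) (by linarith)
end
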